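/- arXiv:1801.00378 — 2 statements merged into one kernel-verified Lean document; each statement's English description precedes it below -/
import Mathlib

section
/- Tropicalization of the Igusa invariants on the dumbbell cone: Assume α₁,…,α₆ ∈ K are pairwise distinct and nonzero with ω_i := −val(α_i) satisfying ω₁ < ω₂ < ω₃ < ω₄ < ω₅ < ω₆, and assume val(6) = 0. Set L₀ = (ω₄ − ω₃)/2, L₁ = 2(ω₅ − ω₄), L₂ = 2(ω₃ − ω₂). Then −val(A⁵/D) = L₁ + 12L₀ + L₂ and −val(A³B/D) = −val(A²C/D) = L₁ + 8L₀ + L₂. -/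
namespace Genus2Igusa

variable {R : Type*} [CommRing R]

/-- `Δ_{ij} = (x − y)²`. -/
def dlt (x y : R) : R := (x - y) ^ 2

/-- Triangle product `Δ_{ij}Δ_{jk}Δ_{ki}`. -/
def tri (x y z : R) : R := dlt x y * dlt y z * dlt z x

/-- Sum over the six bijections between `{i,j,k}` and `{l,m,n}` of
`Δ_{i,σ(i)}Δ_{j,σ(j)}Δ_{k,σ(k)}`. -/
def mtch (i j k l m n : R) : R :=
  dlt i l * dlt j m * dlt k n + dlt i l * dlt j n * dlt k m +
    dlt i m * dlt j l * dlt k n + dlt i m * dlt j n * dlt k l +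
    dlt i n * dlt j l * dlt k m + dlt i n * dlt j m * dlt k l

/-- `A`: sum of `Δ_{ij}Δ_{kl}Δ_{mn}` over the 15 partitions of `{1,…,6}` into three
pairs `{i,j},{k,l},{m,n}`. -/
def igusaA (a₁ a₂ a₃ a₄ a₅ a₆ : R) : R :=
  dlt a₁ a₂ * dlt a₃ a₄ * dlt a₅ a₆ + dlt a₁ a₂ * dlt a₃ a₅ * dlt a₄ a₆ +
    dlt a₁ a₂ * dlt a₃ a₆ * dlt a₄ a₅ +
  dlt a₁ a₃ * dlt a₂ a₄ * dlt a₅ a₆ + dlt a₁ a₃ * dlt a₂ a₅ * dlt a₄ a₆ +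
    dlt a₁ a₃ * dlt a₂ a₆ * dlt a₄ a₅ +
  dlt a₁ a₄ * dlt a₂ a₃ * dlt a₅ a₆ + dlt a₁ a₄ * dlt a₂ a₅ * dlt a₃ a₆ +
    dlt a₁ a₄ * dlt a₂ a₆ * dlt a₃ a₅ +
  dlt a₁ a₅ * dlt a₂ a₃ * dlt a₄ a₆ + dlt a₁ a₅ * dlt a₂ a₄ * dlt a₃ a₆ +
    dlt a₁ a₅ * dlt a₂ a₆ * dlt a₃ a₄ +
  dlt a₁ a₆ * dlt a₂ a₃ * dlt a₄ a₅ + dlt a₁ a₆ * dlt a₂ a₄ * dlt a₃ a₅ +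
    dlt a₁ a₆ * dlt a₂ a₅ * dlt a₃ a₄

/-- `B`: sum of `(Δ_{ij}Δ_{jk}Δ_{ki})(Δ_{lm}Δ_{mn}Δ_{nl})` over the 10 partitions of
`{1,…,6}` into two 3-element sets `{i,j,k},{l,m,n}`. -/
def igusaB (a₁ a₂ a₃ a₄ a₅ a₆ : R) : R :=
  tri a₁ a₂ a₃ * tri a₄ a₅ a₆ + tri a₁ a₂ a₄ * tri a₃ a₅ a₆ +
    tri a₁ a₂ a₅ * tri a₃ a₄ a₆ + tri a₁ a₂ a₆ * tri a₃ a₄ a₅ +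
    tri a₁ a₃ a₄ * tri a₂ a₅ a₆ + tri a₁ a₃ a₅ * tri a₂ a₄ a₆ +
    tri a₁ a₃ a₆ * tri a₂ a₄ a₅ + tri a₁ a₄ a₅ * tri a₂ a₃ a₆ +
    tri a₁ a₄ a₆ * tri a₂ a₃ a₅ + tri a₁ a₅ a₆ * tri a₂ a₃ a₄

/-- `C`: sum of `(Δ_{ij}Δ_{jk}Δ_{ki})(Δ_{lm}Δ_{mn}Δ_{nl})(Δ_{il}Δ_{jm}Δ_{kn})` over the
60 pairs consisting of a partition of `{1,…,6}` into two 3-element sets together with a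
bijection between them. -/
def igusaC (a₁ a₂ a₃ a₄ a₅ a₆ : R) : R :=
  tri a₁ a₂ a₃ * tri a₄ a₅ a₆ * mtch a₁ a₂ a₃ a₄ a₅ a₆ +
    tri a₁ a₂ a₄ * tri a₃ a₅ a₆ * mtch a₁ a₂ a₄ a₃ a₅ a₆ +
    tri a₁ a₂ a₅ * tri a₃ a₄ a₆ * mtch a₁ a₂ a₅ a₃ a₄ a₆ +
    tri a₁ a₂ a₆ * tri a₃ a₄ a₅ * mtch a₁ a₂ a₆ a₃ a₄ a₅ +
    tri a₁ a₃ a₄ * tri a₂ a₅ a₆ * mtch a₁ a₃ a₄ a₂ a₅ a₆ +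
    tri a₁ a₃ a₅ * tri a₂ a₄ a₆ * mtch a₁ a₃ a₅ a₂ a₄ a₆ +
    tri a₁ a₃ a₆ * tri a₂ a₄ a₅ * mtch a₁ a₃ a₆ a₂ a₄ a₅ +
    tri a₁ a₄ a₅ * tri a₂ a₃ a₆ * mtch a₁ a₄ a₅ a₂ a₃ a₆ +
    tri a₁ a₄ a₆ * tri a₂ a₃ a₅ * mtch a₁ a₄ a₆ a₂ a₃ a₅ +
    tri a₁ a₅ a₆ * tri a₂ a₃ a₄ * mtch a₁ a₅ a₆ a₂ a₃ a₄

/-- `D`: product of all `Δ_{ij}` for `1 ≤ i < j ≤ 6`. -/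
def igusaD (a₁ a₂ a₃ a₄ a₅ a₆ : R) : R :=
  dlt a₁ a₂ * dlt a₁ a₃ * dlt a₁ a₄ * dlt a₁ a₅ * dlt a₁ a₆ *
    dlt a₂ a₃ * dlt a₂ a₄ * dlt a₂ a₅ * dlt a₂ a₆ *
    dlt a₃ a₄ * dlt a₃ a₅ * dlt a₃ a₆ *
    dlt a₄ a₅ * dlt a₄ a₆ * dlt a₅ a₆

/-- `x` has leading form `c * M`, with `M` of valuation `w`. -/
def Lead {K : Type*} [Field K] (v : AddValuation K (WithTop ℝ)) (M : K) (w : ℝ) (x c : K) : Prop :=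
  v M = (w : WithTop ℝ) ∧ (w : WithTop ℝ) < v (x - c * M) ∧ 0 ≤ v c

section helpers
variable {K : Type*} [Field K] {v : AddValuation K (WithTop ℝ)}

theorem Lead.add {M : K} {w : ℝ} {x y c d : K} (h : Lead v M w x c) (k : Lead v M w y d) :
    Lead v M w (x + y) (c + d) := by
  refine ⟨h.1, ?_, v.map_le_add h.2.2 k.2.2⟩
  have : x + y - (c + d) * M = (x - c * M) + (y - d * M) := by ring
  rw [this]
  exact v.map_lt_add h.2.1 k.2.1

theorem Lead.le {M : K} {w : ℝ} {x c : K} (h : Lead v M w x c) : (w : WithTop ℝ) ≤ v x := by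
  have : x = (x - c * M) + c * M := by ring
  rw [this]
  refine v.map_le_add h.2.1.le ?_
  rw [v.map_mul, h.1]
  exact le_add_of_nonneg_left h.2.2

theorem coe_lt_add {a b : ℝ} {x y : WithTop ℝ} (h : (a : WithTop ℝ) < x)
    (k : (b : WithTop ℝ) ≤ y) : ((a + b : ℝ) : WithTop ℝ) < x + y := by
  induction x using WithTop.recTopCoe with
  | top => rw [WithTop.top_add]; exact WithTop.coe_lt_top _
  | coe x =>
    induction y using WithTop.recTopCoe with
    | top => rw [WithTop.add_top]; exact WithTop.coe_lt_top _
    | coe y =>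
      rw [← WithTop.coe_add]
      rw [WithTop.coe_lt_coe] at h ⊢
      rw [WithTop.coe_le_coe] at k
      linarith

theorem Lead.mul {M N : K} {w u : ℝ} {x y c d : K} (h : Lead v M w x c) (k : Lead v N u y d) :
    Lead v (M * N) (w + u) (x * y) (c * d) := by
  refine ⟨by rw [v.map_mul, h.1, k.1, WithTop.coe_add], ?_, ?_⟩
  · have : x * y - (c * d) * (M * N) = (x - c * M) * y + (y - d * N) * (c * M) := by ring
    rw [this]
    refine v.map_lt_add ?_ ?_
    · rw [v.map_mul]; exact coe_lt_add h.2.1 k.le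
    · rw [v.map_mul, add_comm w u]
      refine coe_lt_add k.2.1 ?_
      rw [v.map_mul, h.1]
      exact le_add_of_nonneg_left h.2.2
  · rw [v.map_mul]; exact add_nonneg h.2.2 k.2.2

theorem Lead.mul_one {M N : K} {w u : ℝ} {x y : K} (h : Lead v M w x 1) (k : Lead v N u y 1) :
    Lead v (M * N) (w + u) (x * y) 1 := by
  simpa using h.mul k

theorem Lead.cast {M N : K} {w u : ℝ} {x c d : K} (h : Lead v M w x c) (hM : M = N)
    (hw : w = u) (hc : c = d) : Lead v N u x d := by
  subst hM hw hc; exact h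

theorem Lead.castc {M : K} {w : ℝ} {x c d : K} (h : Lead v M w x c) (hc : c = d) :
    Lead v M w x d := by
  subst hc; exact h

theorem Lead.demote {M N : K} {w u : ℝ} {x c : K} (h : Lead v M w x c)
    (hN : v N = (u : WithTop ℝ)) (hw : u < w) : Lead v N u x 0 := by
  refine ⟨hN, ?_, by rw [v.map_zero]; exact le_top⟩
  rw [zero_mul, sub_zero]
  exact lt_of_lt_of_le (WithTop.coe_lt_coe.2 hw) h.le

theorem Lead.val {M : K} {w : ℝ} {x c : K} (h : Lead v M w x c) (hc : v c = 0) :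
    v x = (w : WithTop ℝ) := by
  have e : x = (x - c * M) + c * M := by ring
  have h2 : v (c * M) = (w : WithTop ℝ) := by rw [v.map_mul, hc, h.1, zero_add]
  rw [e, v.map_add_eq_of_lt_right (by rw [h2]; exact h.2.1), h2]

theorem Lead.dlt {a b : K} {p q : ℝ} (ha : v a = ((-p : ℝ) : WithTop ℝ))
    (hb : v b = ((-q : ℝ) : WithTop ℝ)) (h : p < q) :
    Lead v (b ^ 2) (-2 * q) (dlt a b) 1 := by
  have h1 : Lead v b (-q) (a - b) (-1) := by
    refine ⟨hb, ?_, by rw [v.map_neg, v.map_one]⟩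
    have : a - b - -1 * b = a := by ring
    rw [this, ha, WithTop.coe_lt_coe]; linarith
  refine Lead.cast (x := Genus2Igusa.dlt a b) ?_ (pow_two b).symm
    (show -q + -q = -2 * q by ring) (show (-1 : K) * -1 = 1 by ring)
  have := h1.mul h1
  rwa [← pow_two (a - b)] at this

theorem dlt_symm (a b : K) : dlt a b = dlt b a := by unfold dlt; ring

theorem Lead.tri {a b c : K} {p q r : ℝ} (ha : v a = ((-p : ℝ) : WithTop ℝ))
    (hb : v b = ((-q : ℝ) : WithTop ℝ)) (hc : v c = ((-r : ℝ) : WithTop ℝ))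
    (h : p < q) (h' : q < r) :
    Lead v (b ^ 2 * c ^ 4) (-2 * q - 4 * r) (tri a b c) 1 := by
  unfold Genus2Igusa.tri
  rw [dlt_symm c a]
  exact (((Lead.dlt ha hb h).mul_one (Lead.dlt hb hc h')).mul_one
    (Lead.dlt ha hc (h.trans h'))).cast (by ring) (by ring) rfl

theorem val_div {x d : K} {p q r : ℝ} (hx : v x = (p : WithTop ℝ)) (hd : v d = (q : WithTop ℝ))
    (h : p = r + q) : v (x / d) = (r : WithTop ℝ) := by
  have d0 : d ≠ 0 := by
    rintro rfl
    rw [v.map_zero] at hd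
    exact WithTop.top_ne_coe hd
  have e : v (x / d) + (q : WithTop ℝ) = (p : WithTop ℝ) := by
    rw [← hd, ← v.map_mul, div_mul_cancel₀ _ d0, hx]
  revert e
  induction v (x / d) using WithTop.recTopCoe with
  | top => intro e; rw [WithTop.top_add] at e; exact absurd e WithTop.top_ne_coe
  | coe y =>
    intro e
    rw [← WithTop.coe_add, WithTop.coe_inj] at e
    rw [WithTop.coe_inj]; linarith

theorem val_pow_mul {x y : K} {p q : ℝ} (n : ℕ) (hx : v x = (p : WithTop ℝ))
    (hy : v y = (q : WithTop ℝ)) : v (x ^ n * y) = ((n * p + q : ℝ) : WithTop ℝ) := by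
  rw [v.map_mul, v.map_pow, hx, hy, WithTop.coe_add, ← WithTop.coe_nsmul, nsmul_eq_mul]

end helpers

set_option maxHeartbeats 4000000 in
/-- **Tropicalization of the Igusa invariants on the dumbbell cone (Type (I)).**
With `ω₁ < ω₂ < ω₃ < ω₄ < ω₅ < ω₆`, residue characteristic outside `{2,3}`
(`val 6 = 0`), and lengths `L₀ = (ω₄−ω₃)/2`, `L₁ = 2(ω₅−ω₄)`, `L₂ = 2(ω₃−ω₂)`, the
Igusa invariants satisfy `−val j₁ = L₁ + 12L₀ + L₂` and
`−val j₂ = −val j₃ = L₁ + 8L₀ + L₂`. -/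
theorem dumbbell_tropical_igusa_invariants
    {K : Type*} [Field K] (val : K → WithTop ℝ)
    (hval0 : ∀ x : K, val x = ⊤ ↔ x = 0)
    (hvalmul : ∀ x y : K, val (x * y) = val x + val y)
    (hvaladd : ∀ x y : K, min (val x) (val y) ≤ val (x + y))
    (a₁ a₂ a₃ a₄ a₅ a₆ : K)
    (hdist : List.Pairwise (· ≠ ·) [a₁, a₂, a₃, a₄, a₅, a₆])
    (hne : ∀ a ∈ [a₁, a₂, a₃, a₄, a₅, a₆], a ≠ 0)
    (ω₁ ω₂ ω₃ ω₄ ω₅ ω₆ : ℝ)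
    (hω₁ : val a₁ = ((-ω₁ : ℝ) : WithTop ℝ)) (hω₂ : val a₂ = ((-ω₂ : ℝ) : WithTop ℝ))
    (hω₃ : val a₃ = ((-ω₃ : ℝ) : WithTop ℝ)) (hω₄ : val a₄ = ((-ω₄ : ℝ) : WithTop ℝ))
    (hω₅ : val a₅ = ((-ω₅ : ℝ) : WithTop ℝ)) (hω₆ : val a₆ = ((-ω₆ : ℝ) : WithTop ℝ))
    (h₁₂ : ω₁ < ω₂) (h₂₃ : ω₂ < ω₃) (h₃₄ : ω₃ < ω₄) (h₄₅ : ω₄ < ω₅) (h₅₆ : ω₅ < ω₆)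
    (h6 : val (6 : K) = (0 : WithTop ℝ))
    (L₀ L₁ L₂ : ℝ)
    (hL₀ : L₀ = (ω₄ - ω₃) / 2) (hL₁ : L₁ = 2 * (ω₅ - ω₄)) (hL₂ : L₂ = 2 * (ω₃ - ω₂)) :
    let A := igusaA a₁ a₂ a₃ a₄ a₅ a₆
    let B := igusaB a₁ a₂ a₃ a₄ a₅ a₆
    let C := igusaC a₁ a₂ a₃ a₄ a₅ a₆
    let D := igusaD a₁ a₂ a₃ a₄ a₅ a₆
    val (A ^ 5 / D) = ((-(L₁ + 12 * L₀ + L₂) : ℝ) : WithTop ℝ) ∧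
    val (A ^ 3 * B / D) = ((-(L₁ + 8 * L₀ + L₂) : ℝ) : WithTop ℝ) ∧
    val (A ^ 2 * C / D) = ((-(L₁ + 8 * L₀ + L₂) : ℝ) : WithTop ℝ) := by
  intro A B C D
  have hv1 : val 1 = 0 := by
    have h := hvalmul 1 1
    have h' : val 1 ≠ ⊤ := fun h => one_ne_zero ((hval0 1).1 h)
    rw [mul_one] at h
    revert h h'
    induction val 1 using WithTop.recTopCoe with
    | top => intro _ h; exact absurd rfl h
    | coe y =>
      intro h _
      rw [← WithTop.coe_add, WithTop.coe_inj] at h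
      rw [WithTop.coe_eq_zero]; linarith
  obtain ⟨v, hv⟩ : ∃ v : AddValuation K (WithTop ℝ), ∀ x, v x = val x :=
    ⟨AddValuation.of val ((hval0 0).2 rfl) hv1 hvaladd hvalmul, fun x => rfl⟩
  simp only [← hv] at *
  have n2 : 0 ≤ v (2 : K) := by
    rw [← one_add_one_eq_two]; exact v.map_le_add hv1.ge hv1.ge
  have n3 : 0 ≤ v (3 : K) := by
    rw [← two_add_one_eq_three]; exact v.map_le_add n2 hv1.ge
  have v2 : v (2 : K) = 0 := by
    have e : v (2 : K) + v (3 : K) = 0 := by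
      rw [← v.map_mul, ← h6]; norm_num
    refine le_antisymm ?_ n2
    rw [← e]; exact le_add_of_nonneg_right n3
  have v4 : v (4 : K) = 0 := by
    rw [show (4 : K) = 2 * 2 by norm_num, v.map_mul, v2, add_zero]
  have v8 : v (8 : K) = 0 := by
    rw [show (8 : K) = 4 * 2 by norm_num, v.map_mul, v2, v4, add_zero]
  have d12 := Lead.dlt hω₁ hω₂ (by linarith)
  have d21 := d12; rw [dlt_symm] at d21
  have d13 := Lead.dlt hω₁ hω₃ (by linarith)
  have d31 := d13; rw [dlt_symm] at d31
  have d14 := Lead.dlt hω₁ hω₄ (by linarith)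
  have d41 := d14; rw [dlt_symm] at d41
  have d15 := Lead.dlt hω₁ hω₅ (by linarith)
  have d51 := d15; rw [dlt_symm] at d51
  have d16 := Lead.dlt hω₁ hω₆ (by linarith)
  have d61 := d16; rw [dlt_symm] at d61
  have d23 := Lead.dlt hω₂ hω₃ (by linarith)
  have d32 := d23; rw [dlt_symm] at d32
  have d24 := Lead.dlt hω₂ hω₄ (by linarith)
  have d42 := d24; rw [dlt_symm] at d42
  have d25 := Lead.dlt hω₂ hω₅ (by linarith)
  have d52 := d25; rw [dlt_symm] at d52
  have d26 := Lead.dlt hω₂ hω₆ (by linarith)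
  have d62 := d26; rw [dlt_symm] at d62
  have d34 := Lead.dlt hω₃ hω₄ (by linarith)
  have d43 := d34; rw [dlt_symm] at d43
  have d35 := Lead.dlt hω₃ hω₅ (by linarith)
  have d53 := d35; rw [dlt_symm] at d53
  have d36 := Lead.dlt hω₃ hω₆ (by linarith)
  have d63 := d36; rw [dlt_symm] at d63
  have d45 := Lead.dlt hω₄ hω₅ (by linarith)
  have d54 := d45; rw [dlt_symm] at d54
  have d46 := Lead.dlt hω₄ hω₆ (by linarith)
  have d64 := d46; rw [dlt_symm] at d64
  have d56 := Lead.dlt hω₅ hω₆ (by linarith)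
  have d65 := d56; rw [dlt_symm] at d65

  have hMA : v ((a₄ * a₅ * a₆) ^ 2) = ((-2 * (ω₄ + ω₅ + ω₆) : ℝ) : WithTop ℝ) :=
    (Lead.cast ((d14.mul_one d15).mul_one d16) (by ring) (by ring) rfl :
      Lead v ((a₄ * a₅ * a₆) ^ 2) (-2 * (ω₄ + ω₅ + ω₆)) _ 1).1
  have hMB : v (a₃ ^ 2 * a₄ ^ 2 * a₅ ^ 4 * a₆ ^ 4) =
      ((-2 * ω₃ - 2 * ω₄ - 4 * ω₅ - 4 * ω₆ : ℝ) : WithTop ℝ) :=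
    (Lead.cast ((((d13.mul_one d14).mul_one d15).mul_one d15).mul_one (d16.mul_one d16))
        (by ring) (by ring) rfl :
      Lead v (a₃ ^ 2 * a₄ ^ 2 * a₅ ^ 4 * a₆ ^ 4) (-2 * ω₃ - 2 * ω₄ - 4 * ω₅ - 4 * ω₆) _ 1).1
  have hA : Lead v ((a₄ * a₅ * a₆) ^ 2) (-2 * (ω₄ + ω₅ + ω₆)) A 6 := by
    eapply Lead.castc
    · unfold A igusaA
      with_reducible repeat' eapply Lead.add
      all_goals first
        | exact Lead.demote (Lead.mul_one (Lead.mul_one (by assumption) (by assumption)) (by assumption)) hMA (by linarith)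
        | exact Lead.cast (Lead.mul_one (Lead.mul_one (by assumption) (by assumption)) (by assumption)) (by ring) (by ring) rfl
    · norm_num
  obtain ⟨m0, m1, m2, m3, m4, m5, m6, m7, m8, m9⟩ :
      Lead v ((a₄ * a₅ * a₆) ^ 2) (-2 * (ω₄ + ω₅ + ω₆)) (mtch a₁ a₂ a₃ a₄ a₅ a₆) 6 ∧
      Lead v ((a₄ * a₅ * a₆) ^ 2) (-2 * (ω₄ + ω₅ + ω₆)) (mtch a₁ a₂ a₄ a₃ a₅ a₆) 2 ∧
      Lead v ((a₄ * a₅ * a₆) ^ 2) (-2 * (ω₄ + ω₅ + ω₆)) (mtch a₁ a₂ a₅ a₃ a₄ a₆) 2 ∧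
      Lead v ((a₄ * a₅ * a₆) ^ 2) (-2 * (ω₄ + ω₅ + ω₆)) (mtch a₁ a₂ a₆ a₃ a₄ a₅) 2 ∧
      Lead v ((a₄ * a₅ * a₆) ^ 2) (-2 * (ω₄ + ω₅ + ω₆)) (mtch a₁ a₃ a₄ a₂ a₅ a₆) 2 ∧
      Lead v ((a₄ * a₅ * a₆) ^ 2) (-2 * (ω₄ + ω₅ + ω₆)) (mtch a₁ a₃ a₅ a₂ a₄ a₆) 2 ∧
      Lead v ((a₄ * a₅ * a₆) ^ 2) (-2 * (ω₄ + ω₅ + ω₆)) (mtch a₁ a₃ a₆ a₂ a₄ a₅) 2 ∧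
      Lead v ((a₄ * a₅ * a₆) ^ 2) (-2 * (ω₄ + ω₅ + ω₆)) (mtch a₁ a₄ a₅ a₂ a₃ a₆) 2 ∧
      Lead v ((a₄ * a₅ * a₆) ^ 2) (-2 * (ω₄ + ω₅ + ω₆)) (mtch a₁ a₄ a₆ a₂ a₃ a₅) 2 ∧
      Lead v ((a₄ * a₅ * a₆) ^ 2) (-2 * (ω₄ + ω₅ + ω₆)) (mtch a₁ a₅ a₆ a₂ a₃ a₄) 2 := by
    refine ⟨?_, ?_, ?_, ?_, ?_, ?_, ?_, ?_, ?_, ?_⟩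
    all_goals
      eapply Lead.castc
      · unfold mtch
        with_reducible repeat' eapply Lead.add
        all_goals first
          | exact Lead.demote (Lead.mul_one (Lead.mul_one (by assumption) (by assumption)) (by assumption)) hMA (by linarith)
          | exact Lead.cast (Lead.mul_one (Lead.mul_one (by assumption) (by assumption)) (by assumption)) (by ring) (by ring) rfl
      · norm_num
  have t0 := Lead.demote (Lead.mul_one (Lead.tri hω₁ hω₂ hω₃ (by linarith) (by linarith))
    (Lead.tri hω₄ hω₅ hω₆ (by linarith) (by linarith))) hMB (by linarith)
  have t1 := Lead.demote (Lead.mul_one (Lead.tri hω₁ hω₂ hω₄ (by linarith) (by linarith))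
    (Lead.tri hω₃ hω₅ hω₆ (by linarith) (by linarith))) hMB (by linarith)
  have t2 := Lead.demote (Lead.mul_one (Lead.tri hω₁ hω₂ hω₅ (by linarith) (by linarith))
    (Lead.tri hω₃ hω₄ hω₆ (by linarith) (by linarith))) hMB (by linarith)
  have t3 := Lead.demote (Lead.mul_one (Lead.tri hω₁ hω₂ hω₆ (by linarith) (by linarith))
    (Lead.tri hω₃ hω₄ hω₅ (by linarith) (by linarith))) hMB (by linarith)
  have t4 := Lead.demote (Lead.mul_one (Lead.tri hω₁ hω₃ hω₄ (by linarith) (by linarith))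
    (Lead.tri hω₂ hω₅ hω₆ (by linarith) (by linarith))) hMB (by linarith)
  have t5 := Lead.cast (N := a₃ ^ 2 * a₄ ^ 2 * a₅ ^ 4 * a₆ ^ 4) (u := -2 * ω₃ - 2 * ω₄ - 4 * ω₅ - 4 * ω₆) (Lead.mul_one (Lead.tri hω₁ hω₃ hω₅ (by linarith) (by linarith))
    (Lead.tri hω₂ hω₄ hω₆ (by linarith) (by linarith))) (by ring) (by ring) rfl
  have t6 := Lead.cast (N := a₃ ^ 2 * a₄ ^ 2 * a₅ ^ 4 * a₆ ^ 4) (u := -2 * ω₃ - 2 * ω₄ - 4 * ω₅ - 4 * ω₆) (Lead.mul_one (Lead.tri hω₁ hω₃ hω₆ (by linarith) (by linarith))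
    (Lead.tri hω₂ hω₄ hω₅ (by linarith) (by linarith))) (by ring) (by ring) rfl
  have t7 := Lead.cast (N := a₃ ^ 2 * a₄ ^ 2 * a₅ ^ 4 * a₆ ^ 4) (u := -2 * ω₃ - 2 * ω₄ - 4 * ω₅ - 4 * ω₆) (Lead.mul_one (Lead.tri hω₁ hω₄ hω₅ (by linarith) (by linarith))
    (Lead.tri hω₂ hω₃ hω₆ (by linarith) (by linarith))) (by ring) (by ring) rfl
  have t8 := Lead.cast (N := a₃ ^ 2 * a₄ ^ 2 * a₅ ^ 4 * a₆ ^ 4) (u := -2 * ω₃ - 2 * ω₄ - 4 * ω₅ - 4 * ω₆) (Lead.mul_one (Lead.tri hω₁ hω₄ hω₆ (by linarith) (by linarith))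
    (Lead.tri hω₂ hω₃ hω₅ (by linarith) (by linarith))) (by ring) (by ring) rfl
  have t9 := Lead.demote (Lead.mul_one (Lead.tri hω₁ hω₅ hω₆ (by linarith) (by linarith))
    (Lead.tri hω₂ hω₃ hω₄ (by linarith) (by linarith))) hMB (by linarith)
  have hB : Lead v _ _ B 4 := Lead.cast
    (((((((((t0.add t1).add t2).add t3).add t4).add t5).add t6).add t7).add t8).add t9) rfl rfl (by norm_num)
  have hC : Lead v _ _ C 8 := Lead.cast
    ((((((((((t0.mul m0).add (t1.mul m1)).add (t2.mul m2)).add (t3.mul m3)).add (t4.mul m4)).add (t5.mul m5)).add (t6.mul m6)).add (t7.mul m7)).add (t8.mul m8)).add (t9.mul m9)) rfl rfl (by norm_num)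
  have hD : Lead v _ _ D 1 :=
    ((((((((((((((d12.mul_one d13).mul_one d14).mul_one d15).mul_one d16).mul_one d23).mul_one d24).mul_one d25).mul_one d26).mul_one d34).mul_one d35).mul_one d36).mul_one d45).mul_one d46).mul_one d56)
  have eA := hA.val h6
  have eB := hB.val v4
  have eC := hC.val v8
  have eD := hD.val hv1
  refine ⟨?_, ?_, ?_⟩
  · rw [pow_succ A 4]
    exact val_div (val_pow_mul 4 eA eA) eD (by subst hL₀ hL₁ hL₂; push_cast; ring)
  · exact val_div (val_pow_mul 3 eA eB) eD (by subst hL₀ hL₁ hL₂; push_cast; ring)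
  · exact val_div (val_pow_mul 2 eA eC) eD (by subst hL₀ hL₁ hL₂; push_cast; ring)

end Genus2Igusa
end

section
/- Tropical Igusa invariants in residue characteristic 3 (Type (I), non-generic regime): Assume α₁,…,α₆ ∈ K are pairwise distinct and nonzero with ω_i := −val(α_i) satisfying ω₁ < ω₂ < ω₃ < ω₄ < ω₅ < ω₆, and assume val(2) = 0, val(3) > 0, and val(3) > ω₄ − ω₃. Then val(A) = −(ω₃ + ω₄ + 2ω₅ + 2ω₆) and val(A + 4α₃α₄α₅²α₆²) > val(A); consequently, with L₀ = (ω₄ − ω₃)/2, L₁ = 2(ω₅ − ω₄), L₂ = 2(ω₃ − ω₂), one has −val(A⁵/D) = −val(A³B/D) = L₁ + 2L₀ + L₂ and −val(A²C/D) = L₁ + 4L₀ + L₂. -/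
namespace Genus2Igusa

variable {R : Type*} [CommRing R]

section helpers

structure IsV {K : Type*} [Field K] (v : K → WithTop ℝ) : Prop where
  top : ∀ x : K, v x = ⊤ ↔ x = 0
  mul : ∀ x y : K, v (x * y) = v x + v y
  add : ∀ x y : K, min (v x) (v y) ≤ v (x + y)

def Sz {K : Type*} (v : K → WithTop ℝ) (x : K) (r : ℝ) : Prop := v x = ((-r : ℝ) : WithTop ℝ)
def Lt {K : Type*} (v : K → WithTop ℝ) (x : K) (r : ℝ) : Prop := ((-r : ℝ) : WithTop ℝ) < v x

variable {K : Type*} [Field K] {v : K → WithTop ℝ}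

theorem IsV.one (h : IsV v) : v 1 = 0 := by
  have h1 := h.mul 1 1
  have h2 : v 1 ≠ ⊤ := by rw [Ne, h.top]; exact one_ne_zero
  lift v 1 to ℝ using h2 with r hr
  rw [mul_one, ← hr] at h1
  norm_cast at h1 ⊢
  linarith

theorem IsV.neg_one (h : IsV v) : v (-1) = 0 := by
  have h1 := h.mul (-1) (-1)
  have h2 : v (-1) ≠ ⊤ := by rw [Ne, h.top]; simp
  rw [neg_mul_neg, one_mul, h.one] at h1
  lift v (-1) to ℝ using h2 with r hr
  norm_cast at h1 ⊢
  linarith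

theorem IsV.neg (h : IsV v) (x : K) : v (-x) = v x := by
  rw [← neg_one_mul, h.mul, h.neg_one, zero_add]

theorem Sz.mul (h : IsV v) {x y : K} {r s : ℝ} (hx : Sz v x r) (hy : Sz v y s) :
    Sz v (x * y) (r + s) := by
  unfold Sz at *
  rw [h.mul, hx, hy, ← WithTop.coe_add]
  congr 1; ring

theorem Sz.pow (h : IsV v) {x : K} {r : ℝ} (hx : Sz v x r) (n : ℕ) :
    Sz v (x ^ n) (n * r) := by
  induction n with
  | zero => simp [Sz, h.one]
  | succ n ih =>
    rw [pow_succ]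
    have := ih.mul h hx
    convert this using 1
    push_cast; ring

theorem Sz.ne (h : IsV v) {x : K} {r : ℝ} (hx : Sz v x r) : x ≠ 0 := by
  rw [Ne, ← h.top, hx]; simp

theorem Sz.div (h : IsV v) {x y : K} {r s : ℝ} (hx : Sz v x r) (hy : Sz v y s) :
    Sz v (x / y) (r - s) := by
  have h1 := h.mul (x / y) y
  rw [div_mul_cancel₀ _ (hy.ne h), hx, hy] at h1
  unfold Sz
  have h2 : v (x / y) ≠ ⊤ := by
    rw [Ne, h.top]; exact div_ne_zero (hx.ne h) (hy.ne h)
  lift v (x / y) to ℝ using h2 with t ht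
  norm_cast at h1 ⊢
  linarith

theorem Sz.neg (h : IsV v) {x : K} {r : ℝ} (hx : Sz v x r) : Sz v (-x) r := by
  unfold Sz at *; rw [h.neg, hx]

theorem Sz.cast {x : K} {r s : ℝ} (hx : Sz v x r) (hs : r = s) : Sz v x s := hs ▸ hx

theorem Sz.lt {x : K} {r s : ℝ} (hx : Sz v x r) (hs : r < s) : Lt v x s := by
  unfold Lt; rw [hx]; exact_mod_cast neg_lt_neg hs

theorem Lt.add (h : IsV v) {x y : K} {r : ℝ} (hx : Lt v x r) (hy : Lt v y r) :
    Lt v (x + y) r := lt_of_lt_of_le (lt_min hx hy) (h.add x y)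

theorem Lt.neg (h : IsV v) {x : K} {r : ℝ} (hx : Lt v x r) : Lt v (-x) r := by
  unfold Lt at *; rwa [h.neg]

theorem Lt.mulSz (h : IsV v) {x y : K} {r s : ℝ} (hx : Lt v x r) (hy : Sz v y s) :
    Lt v (x * y) (r + s) := by
  unfold Lt at *
  rw [h.mul, hy]
  by_cases h2 : v x = ⊤
  · rw [h2, WithTop.top_add]; exact WithTop.coe_lt_top _
  lift v x to ℝ using h2 with t ht
  norm_cast at hx ⊢
  linarith

theorem Sz.add_lt (h : IsV v) {x y : K} {r : ℝ} (hx : Sz v x r) (hy : Lt v y r) :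
    Sz v (x + y) r := by
  apply le_antisymm
  · by_contra hc
    have h1 : Lt v (x + y) r := not_le.mp hc
    have h2 := h1.add h (hy.neg h)
    rw [add_neg_cancel_right] at h2
    unfold Lt at h2
    rw [hx] at h2
    exact lt_irrefl _ h2
  · refine le_trans ?_ (h.add x y)
    exact le_min hx.ge (le_of_lt hy)

def Nr (v : K → WithTop ℝ) (x y : K) (r : ℝ) : Prop := Sz v x r ∧ Sz v y r ∧ Lt v (x - y) r

theorem Nr.mul (h : IsV v) {x y x' y' : K} {r r' : ℝ} (hx : Nr v x y r) (hx' : Nr v x' y' r') :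
    Nr v (x * x') (y * y') (r + r') := by
  refine ⟨hx.1.mul h hx'.1, hx.2.1.mul h hx'.2.1, ?_⟩
  have h1 := hx.2.2.mulSz h hx'.1
  have h2 := hx'.2.2.mulSz h hx.2.1
  rw [add_comm r' r] at h2
  have h3 := h1.add h h2
  convert h3 using 1
  ring

theorem Nr.fin {t m M : K} {r w : ℝ} (ht : Nr v t m r) (hm : m = M) (hr : r = w) :
    Lt v (t - M) w := by
  subst hm hr; exact ht.2.2

def Qc (v : K → WithTop ℝ) (M : K) (w : ℝ) (c : ℕ) (X : K) : Prop := Lt v (X - c * M) w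

theorem Qc.step0 (h : IsV v) {M : K} {w : ℝ} {c : ℕ} {X t : K} (hX : Qc v M w c X)
    (ht : Lt v t w) : Qc v M w c (X + t) := by
  have h3 := Lt.add h hX ht
  unfold Qc
  convert h3 using 1
  ring

theorem Qc.step1 (h : IsV v) {M : K} {w : ℝ} {c : ℕ} {X t : K} (hc : 0 < c)
    (hX : Qc v M w (c - 1) X) (ht : Lt v (t - M) w) : Qc v M w c (X + t) := by
  have h3 := Lt.add h hX ht
  unfold Qc
  convert h3 using 1
  rw [Nat.cast_sub hc]
  push_cast; ring

theorem Qc.zero (h : IsV v) {M : K} {w : ℝ} : Qc v M w 0 0 := by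
  unfold Qc Lt
  have : (0 : K) - ((0 : ℕ) : K) * M = 0 := by simp
  rw [this, (h.top 0).2 rfl]
  exact WithTop.coe_lt_top _

theorem Qc.sz (h : IsV v) {M : K} {w : ℝ} {c : ℕ} {X : K} (hX : Qc v M w c X)
    (hM : Sz v M w) (hc : Sz v (c : K) 0) : Sz v X w := by
  have h1 := hc.mul h hM
  rw [zero_add] at h1
  have := h1.add_lt h hX
  simpa using this

theorem dlt_comm (x y : K) : dlt x y = dlt y x := by unfold dlt; ring

/-- Facts about a pair `x` smaller than `y`. -/
theorem p_sz (h : IsV v) (h2 : Sz v (2 : K) 0) {x y : K} {r s : ℝ} (hx : Sz v x r)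
    (hy : Sz v y s) (hrs : r < s) : Sz v (dlt x y - y ^ 2) (r + s) := by
  have h1 : Sz v (-(2 * y) + x) s := by
    refine Sz.add_lt h ?_ (hx.lt hrs)
    have := (h2.mul h hy).neg h
    rwa [zero_add] at this
  have := hx.mul h h1
  convert this using 1
  unfold dlt; ring

theorem d_nr (h : IsV v) (h2 : Sz v (2 : K) 0) {x y : K} {r s : ℝ} (hx : Sz v x r)
    (hy : Sz v y s) (hrs : r < s) : Nr v (dlt x y) (y ^ 2) (2 * s) := by
  have h1 : Sz v (y ^ 2) (2 * s) := by simpa using hy.pow h 2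
  have h3 : Lt v (dlt x y - y ^ 2) (2 * s) := (p_sz h h2 hx hy hrs).lt (by linarith)
  refine ⟨?_, h1, h3⟩
  have := h1.add_lt h h3
  simpa using this

/-- A leading term of `A`. -/
theorem A_lead (h : IsV v) (h2 : Sz v (2 : K) 0) {l a b x y z : K} {rl ra rb rx ry rz w : ℝ}
    (hl : Sz v l rl) (ha : Sz v a ra) (hb : Sz v b rb) (hx : Sz v x rx) (hy : Sz v y ry)
    (hz : Sz v z rz) (h1 : rl < rx) (h3 : ra < ry) (h4 : rb < rz)
    (e1 : 2 * rl + 2 * ry + 2 * rz < w) (e2 : 2 * rx + ra + ry + 2 * rz < w)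
    (e3 : 2 * rx + 2 * ry + rb + rz < w) :
    Lt v (dlt l x * dlt a y * dlt b z - (x ^ 2 - 2 * x * l) * y ^ 2 * z ^ 2) w := by
  have d1 := (d_nr h h2 hl hx h1).1
  have d3 := (d_nr h h2 hb hz h4).1
  have p2 := p_sz h h2 ha hy h3
  have p3 := p_sz h h2 hb hz h4
  have q1 : Lt v (l ^ 2 * y ^ 2 * z ^ 2) w :=
    (((hl.pow h 2).mul h (hy.pow h 2)).mul h (hz.pow h 2)).lt (by push_cast; linarith)
  have q2 : Lt v (dlt l x * (dlt a y - y ^ 2) * dlt b z) w :=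
    ((d1.mul h p2).mul h d3).lt (by linarith)
  have q3 : Lt v (dlt l x * y ^ 2 * (dlt b z - z ^ 2)) w :=
    ((d1.mul h (hy.pow h 2)).mul h p3).lt (by push_cast; linarith)
  have := (q1.add h q2).add h q3
  convert this using 1
  simp only [dlt]; ring

theorem A_lead' (h : IsV v) (h2 : Sz v (2 : K) 0) {l a b x y z : K} {rl ra rb rx ry rz w : ℝ}
    (hl : Sz v l rl) (ha : Sz v a ra) (hb : Sz v b rb) (hx : Sz v x rx) (hy : Sz v y ry)
    (hz : Sz v z rz) (h1 : rl < rx) (h3 : ra < ry) (h4 : rb < rz)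
    (e1 : 2 * rl + 2 * ry + 2 * rz < w) (e2 : 2 * rx + ra + ry + 2 * rz < w)
    (e3 : 2 * rx + 2 * ry + rb + rz < w) (e4 : rl + rx + 2 * ry + 2 * rz < w) :
    Lt v (dlt l x * dlt a y * dlt b z - x ^ 2 * y ^ 2 * z ^ 2) w := by
  have q := A_lead h h2 hl ha hb hx hy hz h1 h3 h4 e1 e2 e3
  have q1 : Lt v (2 * (l * x * y ^ 2 * z ^ 2)) w :=
    (h2.mul h (((hl.mul h hx).mul h (hy.pow h 2)).mul h (hz.pow h 2))).lt
      (by push_cast; linarith)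
  have := q.add h (q1.neg h)
  convert this using 1
  ring

end helpers

set_option maxHeartbeats 4000000 in
/-- **Tropical Igusa invariants in residue characteristic 3 (Type (I), non-generic
regime).** With `ω₁ < ω₂ < ω₃ < ω₄ < ω₅ < ω₆`, `val 2 = 0`, `val 3 > 0` and
`val 3 > ω₄ − ω₃`, we get `val A = −(ω₃ + ω₄ + 2ω₅ + 2ω₆)` with initial term
`−4α₃α₄α₅²α₆²`, and the stated formulas for the tropical Igusa invariants. -/
theorem char3_typeI_tropical_igusa_invariants
    {K : Type*} [Field K] (val : K → WithTop ℝ)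
    (hval0 : ∀ x : K, val x = ⊤ ↔ x = 0)
    (hvalmul : ∀ x y : K, val (x * y) = val x + val y)
    (hvaladd : ∀ x y : K, min (val x) (val y) ≤ val (x + y))
    (a₁ a₂ a₃ a₄ a₅ a₆ : K)
    (hdist : List.Pairwise (· ≠ ·) [a₁, a₂, a₃, a₄, a₅, a₆])
    (hne : ∀ a ∈ [a₁, a₂, a₃, a₄, a₅, a₆], a ≠ 0)
    (ω₁ ω₂ ω₃ ω₄ ω₅ ω₆ : ℝ)
    (hω₁ : val a₁ = ((-ω₁ : ℝ) : WithTop ℝ)) (hω₂ : val a₂ = ((-ω₂ : ℝ) : WithTop ℝ))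
    (hω₃ : val a₃ = ((-ω₃ : ℝ) : WithTop ℝ)) (hω₄ : val a₄ = ((-ω₄ : ℝ) : WithTop ℝ))
    (hω₅ : val a₅ = ((-ω₅ : ℝ) : WithTop ℝ)) (hω₆ : val a₆ = ((-ω₆ : ℝ) : WithTop ℝ))
    (h₁₂ : ω₁ < ω₂) (h₂₃ : ω₂ < ω₃) (h₃₄ : ω₃ < ω₄) (h₄₅ : ω₄ < ω₅) (h₅₆ : ω₅ < ω₆)
    (h2 : val (2 : K) = (0 : WithTop ℝ))
    (h3pos : (0 : WithTop ℝ) < val (3 : K))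
    (h3 : ((ω₄ - ω₃ : ℝ) : WithTop ℝ) < val (3 : K))
    (L₀ L₁ L₂ : ℝ)
    (hL₀ : L₀ = (ω₄ - ω₃) / 2) (hL₁ : L₁ = 2 * (ω₅ - ω₄)) (hL₂ : L₂ = 2 * (ω₃ - ω₂)) :
    let A := igusaA a₁ a₂ a₃ a₄ a₅ a₆
    let B := igusaB a₁ a₂ a₃ a₄ a₅ a₆
    let C := igusaC a₁ a₂ a₃ a₄ a₅ a₆
    let D := igusaD a₁ a₂ a₃ a₄ a₅ a₆
    val A = ((-(ω₃ + ω₄ + 2 * ω₅ + 2 * ω₆) : ℝ) : WithTop ℝ) ∧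
    val (A + 4 * (a₃ * a₄ * a₅ ^ 2 * a₆ ^ 2)) > val A ∧
    val (A ^ 5 / D) = ((-(L₁ + 2 * L₀ + L₂) : ℝ) : WithTop ℝ) ∧
    val (A ^ 3 * B / D) = ((-(L₁ + 2 * L₀ + L₂) : ℝ) : WithTop ℝ) ∧
    val (A ^ 2 * C / D) = ((-(L₁ + 4 * L₀ + L₂) : ℝ) : WithTop ℝ) := by
  intro A B C D
  have h : IsV val := ⟨hval0, hvalmul, hvaladd⟩
  have s2 : Sz val (2 : K) 0 := by unfold Sz; rw [h2]; simp
  have s4 : Sz val ((4 : ℕ) : K) 0 := by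
    have := s2.mul h s2
    convert this using 1 <;> norm_num
  have s8 : Sz val ((8 : ℕ) : K) 0 := by
    have := s4.mul h s2
    convert this using 1 <;> norm_num
  have z1 : Sz val a₁ ω₁ := hω₁
  have z2 : Sz val a₂ ω₂ := hω₂
  have z3 : Sz val a₃ ω₃ := hω₃
  have z4 : Sz val a₄ ω₄ := hω₄
  have z5 : Sz val a₅ ω₅ := hω₅
  have z6 : Sz val a₆ ω₆ := hω₆
  have n12 := d_nr h s2 z1 z2 (by linarith)
  have d12 := n12.1
  have n13 := d_nr h s2 z1 z3 (by linarith)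
  have d13 := n13.1
  have n14 := d_nr h s2 z1 z4 (by linarith)
  have d14 := n14.1
  have n15 := d_nr h s2 z1 z5 (by linarith)
  have d15 := n15.1
  have n16 := d_nr h s2 z1 z6 (by linarith)
  have d16 := n16.1
  have n23 := d_nr h s2 z2 z3 (by linarith)
  have d23 := n23.1
  have n24 := d_nr h s2 z2 z4 (by linarith)
  have d24 := n24.1
  have n25 := d_nr h s2 z2 z5 (by linarith)
  have d25 := n25.1
  have n26 := d_nr h s2 z2 z6 (by linarith)
  have d26 := n26.1
  have n34 := d_nr h s2 z3 z4 (by linarith)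
  have d34 := n34.1
  have n35 := d_nr h s2 z3 z5 (by linarith)
  have d35 := n35.1
  have n36 := d_nr h s2 z3 z6 (by linarith)
  have d36 := n36.1
  have n45 := d_nr h s2 z4 z5 (by linarith)
  have d45 := n45.1
  have n46 := d_nr h s2 z4 z6 (by linarith)
  have d46 := n46.1
  have n56 := d_nr h s2 z5 z6 (by linarith)
  have d56 := n56.1
  have hD : Sz val D (2 * ω₂ + 4 * ω₃ + 6 * ω₄ + 8 * ω₅ + 10 * ω₆) := by
    apply Sz.cast
    case hx =>
      show Sz val (igusaD a₁ a₂ a₃ a₄ a₅ a₆) _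
      unfold igusaD
      repeat' first | (show Sz _ _ _; assumption) | apply Sz.mul h
    case hs => ring
  have hB : Sz val B (2 * ω₃ + 2 * ω₄ + 4 * ω₅ + 4 * ω₆) := by
    have q : Qc val (a₃ ^ 2 * a₄ ^ 2 * a₅ ^ 4 * a₆ ^ 4) (2 * ω₃ + 2 * ω₄ + 4 * ω₅ + 4 * ω₆) 4 (0 + B) := by
      simp only [B, igusaB, tri, mtch, dlt_comm a₂ a₁, dlt_comm a₃ a₁, dlt_comm a₄ a₁, dlt_comm a₅ a₁, dlt_comm a₆ a₁, dlt_comm a₃ a₂, dlt_comm a₄ a₂, dlt_comm a₅ a₂, dlt_comm a₆ a₂, dlt_comm a₄ a₃, dlt_comm a₅ a₃, dlt_comm a₆ a₃, dlt_comm a₅ a₄, dlt_comm a₆ a₄, dlt_comm a₆ a₅, mul_add, ← add_assoc]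
      repeat' first
        | exact Qc.zero h
        | (apply Qc.step0 h
           case ht =>
             apply Sz.lt
             case hx => repeat' first | (show Sz _ _ _; assumption) | apply Sz.mul h
             case hs => linarith)
        | (apply Qc.step1 h (by decide)
           case ht =>
             apply Nr.fin
             case ht => repeat' first | (show Nr _ _ _ _; assumption) | apply Nr.mul h
             case hm => ring1
             case hr => ring1)
    rw [zero_add] at q
    refine q.sz h ?_ s4
    have := (((z3.pow h 2).mul h (z4.pow h 2)).mul h (z5.pow h 4)).mul h (z6.pow h 4)
    push_cast at this
    exact this
  have hC : Sz val C (2 * ω₃ + 4 * ω₄ + 6 * ω₅ + 6 * ω₆) := by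
    have q : Qc val (a₃ ^ 2 * a₄ ^ 4 * a₅ ^ 6 * a₆ ^ 6) (2 * ω₃ + 4 * ω₄ + 6 * ω₅ + 6 * ω₆) 8 (0 + C) := by
      simp only [C, igusaC, tri, mtch, dlt_comm a₂ a₁, dlt_comm a₃ a₁, dlt_comm a₄ a₁, dlt_comm a₅ a₁, dlt_comm a₆ a₁, dlt_comm a₃ a₂, dlt_comm a₄ a₂, dlt_comm a₅ a₂, dlt_comm a₆ a₂, dlt_comm a₄ a₃, dlt_comm a₅ a₃, dlt_comm a₆ a₃, dlt_comm a₅ a₄, dlt_comm a₆ a₄, dlt_comm a₆ a₅, mul_add, ← add_assoc]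
      repeat' first
        | exact Qc.zero h
        | (apply Qc.step0 h
           case ht =>
             apply Sz.lt
             case hx => repeat' first | (show Sz _ _ _; assumption) | apply Sz.mul h
             case hs => linarith)
        | (apply Qc.step1 h (by decide)
           case ht =>
             apply Nr.fin
             case ht => repeat' first | (show Nr _ _ _ _; assumption) | apply Nr.mul h
             case hm => ring1
             case hr => ring1)
    rw [zero_add] at q
    refine q.sz h ?_ s8
    have := (((z3.pow h 2).mul h (z4.pow h 4)).mul h (z5.pow h 6)).mul h (z6.pow h 6)
    push_cast at this
    exact this
  set w : ℝ := ω₃ + ω₄ + 2 * ω₅ + 2 * ω₆ with hw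
  have hN : Sz val (4 * (a₃ * a₄ * a₅ ^ 2 * a₆ ^ 2)) w := by
    have := s4.mul h (((z3.mul h z4).mul h (z5.pow h 2)).mul h (z6.pow h 2))
    push_cast at this
    convert this using 1
    rw [hw]; ring
  have h6 : Lt val (3 * (2 * (a₄ ^ 2 * a₅ ^ 2 * a₆ ^ 2))) w := by
    have h3' : Lt val (3 : K) (ω₃ - ω₄) := by
      unfold Lt; rwa [neg_sub]
    have := h3'.mulSz h (s2.mul h (((z4.pow h 2).mul h (z5.pow h 2)).mul h (z6.pow h 2)))
    push_cast at this
    convert this using 1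
    rw [hw]; ring
  have t1 := A_lead' (w := w) h s2 z1 z2 z3 z4 z5 z6 (by linarith) (by linarith) (by linarith)
    (by linarith) (by linarith) (by linarith) (by linarith)
  have t2 := A_lead' (w := w) h s2 z1 z3 z2 z4 z5 z6 (by linarith) (by linarith) (by linarith)
    (by linarith) (by linarith) (by linarith) (by linarith)
  have t3 := A_lead' (w := w) h s2 z2 z1 z3 z4 z5 z6 (by linarith) (by linarith) (by linarith)
    (by linarith) (by linarith) (by linarith) (by linarith)
  have t4 := A_lead (w := w) h s2 z3 z1 z2 z4 z5 z6 (by linarith) (by linarith) (by linarith)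
    (by linarith) (by linarith) (by linarith)
  have t5 := A_lead' (w := w) h s2 z2 z3 z1 z4 z5 z6 (by linarith) (by linarith) (by linarith)
    (by linarith) (by linarith) (by linarith) (by linarith)
  have t6 := A_lead (w := w) h s2 z3 z2 z1 z4 z5 z6 (by linarith) (by linarith) (by linarith)
    (by linarith) (by linarith) (by linarith)
  have t7 := ((d12.mul h d34).mul h d56).lt (s := w) (by linarith)
  have t8 := ((d12.mul h d35).mul h d46).lt (s := w) (by linarith)
  have t9 := ((d12.mul h d45).mul h d36).lt (s := w) (by linarith)
  have t10 := ((d13.mul h d24).mul h d56).lt (s := w) (by linarith)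
  have t11 := ((d13.mul h d25).mul h d46).lt (s := w) (by linarith)
  have t12 := ((d13.mul h d45).mul h d26).lt (s := w) (by linarith)
  have t13 := ((d23.mul h d14).mul h d56).lt (s := w) (by linarith)
  have t14 := ((d23.mul h d15).mul h d46).lt (s := w) (by linarith)
  have t15 := ((d23.mul h d45).mul h d16).lt (s := w) (by linarith)
  have hA4 : Lt val (A + 4 * (a₃ * a₄ * a₅ ^ 2 * a₆ ^ 2)) w := by
    have := (((((((((((((((h6.add h t1).add h t2).add h t3).add h t4).add h t5).add h t6).add h t7).add h t8).add h t9).add h t10).add h t11).add h t12).add h t13).add h t14).add h t15)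
    convert this using 1
    simp only [A, igusaA]
    ring
  have hA : Sz val A w := by
    have := (hN.neg h).add_lt h hA4
    simpa using this
  refine ⟨hA, ?_, ?_, ?_, ?_⟩
  · show val A < _
    rw [hA]; exact hA4
  · have := (hA.pow h 5).div h hD
    rw [this]; congr 1; rw [hL₀, hL₁, hL₂, hw]; push_cast; ring
  · have := ((hA.pow h 3).mul h hB).div h hD
    rw [this]; congr 1; rw [hL₀, hL₁, hL₂, hw]; push_cast; ring
  · have := ((hA.pow h 2).mul h hC).div h hD
    rw [this]; congr 1; rw [hL₀, hL₁, hL₂, hw]; push_cast; ring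

end Genus2Igusa
end
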